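/- Let m, n ≥ 1 be integers and let f be a bounded continuous function on [0,∞) such that f ∈ W²_0(ψ), D̃f ∈ W²_0(ψ), and D̃f, D̃²f are bounded and continuous on (0,∞) with limit 0 at x = 0. Then Ṽ_m(Ṽ_n f) = Ṽ_n(Ṽ_m f) on [0,∞). -/

import Mathlib

open MeasureTheory Filter Set

/-- Baskakov basis functions `P_{n,k}(x)`, with `P_{n,k} := 0` for `k < 0`. -/
noncomputable def P (n : ℕ) (k : ℤ) (x : ℝ) : ℝ :=
  if k < 0 then 0
  else (Nat.choose (n + k.toNat - 1) k.toNat : ℝ) * x ^ k.toNat * (1 + x) ^ (-(n : ℤ) - k)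

/-- The weight `ψ(x) = x(1+x)`. -/
noncomputable def psi (x : ℝ) : ℝ := x * (1 + x)

/-- The differential operator `D̃ f = ψ f''`. -/
noncomputable def Dt (f : ℝ → ℝ) : ℝ → ℝ := fun x => psi x * deriv (deriv f) x

/-- The functionals `v_{n,k}`. -/
noncomputable def v (n k : ℕ) (f : ℝ → ℝ) : ℝ :=
  if k = 0 then f 0
  else ((n : ℝ) + 1) * ∫ t in Set.Ioi (0 : ℝ), P (n + 2) ((k : ℤ) - 1) t * f t

/-- The Goodman–Sharma–Baskakov operator `V_n`. -/
noncomputable def V (n : ℕ) (f : ℝ → ℝ) (x : ℝ) : ℝ :=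
  ∑' k : ℕ, v n k f * P n (k : ℤ) x

/-- The modified operator `Ṽ_n`. -/
noncomputable def Vt (n : ℕ) (f : ℝ → ℝ) (x : ℝ) : ℝ :=
  ∑' k : ℕ, v n k f * (P n (k : ℤ) x - (1 / (n : ℝ)) * Dt (P n (k : ℤ)) x)

/-- Supremum norm on `[0,∞)`. -/
noncomputable def supNorm (f : ℝ → ℝ) : ℝ := ⨆ x ∈ Set.Ici (0 : ℝ), |f x|

/-- `f` is bounded and continuous on `[0,∞)`. -/
def BddContOn (f : ℝ → ℝ) : Prop :=
  ContinuousOn f (Set.Ici 0) ∧ ∃ M, ∀ x ∈ Set.Ici (0 : ℝ), |f x| ≤ M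

/-- The space `W²(ψ)`: `g, g'` (locally) differentiable on `(0,∞)` and `D̃ g` bounded. -/
def MemW2 (g : ℝ → ℝ) : Prop :=
  DifferentiableOn ℝ g (Set.Ioi 0) ∧ DifferentiableOn ℝ (deriv g) (Set.Ioi 0) ∧
    ∃ M, ∀ x ∈ Set.Ioi (0 : ℝ), |Dt g x| ≤ M

/-- The space `W²₀(ψ)`: members of `W²(ψ)` with `D̃ g(x) → 0` as `x → 0⁺`. -/
def MemW20 (g : ℝ → ℝ) : Prop :=
  MemW2 g ∧ Filter.Tendsto (Dt g) (nhdsWithin 0 (Set.Ioi 0)) (nhds 0)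

/-- The K-functional `K(f,t)`. -/
noncomputable def Kfun (f : ℝ → ℝ) (t : ℝ) : ℝ :=
  sInf {a : ℝ | ∃ g : ℝ → ℝ, MemW20 g ∧ MemW2 (Dt g) ∧
    a = supNorm (fun x => f x - g x) + t * supNorm (Dt (Dt g))}

/-- The function `T_{n,k}(x)`. -/
noncomputable def T (n : ℕ) (k : ℤ) (x : ℝ) : ℝ :=
  (k : ℝ) * ((k : ℝ) - 1) * (1 + x) / x - 2 * (k : ℝ) * ((n : ℝ) + (k : ℝ))
    + ((n : ℝ) + (k : ℝ)) * ((n : ℝ) + (k : ℝ) + 1) * x / (1 + x)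

section Basis

lemma P_natCast (n k : ℕ) (x : ℝ) :
    P n k x = (Nat.choose (n + k - 1) k : ℝ) * x ^ k * ((1 + x) ^ (n + k))⁻¹ := by
  have h : (-(n : ℤ) - (k : ℤ)) = -((n + k : ℕ) : ℤ) := by push_cast; ring
  simp only [P, Int.toNat_natCast, h, zpow_neg, zpow_natCast]
  simp

lemma P_zero_right (n k : ℕ) : P n k 0 = if k = 0 then 1 else 0 := by
  rw [P_natCast]
  rcases k with _ | k <;> simp

lemma P_one (k : ℕ) (x : ℝ) : P 1 k x = x ^ k * ((1 + x) ^ (1 + k))⁻¹ := by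
  rw [P_natCast]; simp

lemma P_nonneg (n k : ℕ) {x : ℝ} (hx : 0 ≤ x) : 0 ≤ P n k x := by
  rw [P_natCast]; positivity

lemma choose_weight_succ {n : ℕ} (hn : 1 ≤ n) (k : ℕ) :
    (n : ℝ) * (Nat.choose (n + 1 + k - 1) k : ℝ) = (n + k) * (Nat.choose (n + k - 1) k : ℝ) := by
  obtain ⟨n, rfl⟩ := Nat.exists_eq_add_of_le' hn
  have e1 : n + 1 + 1 + k - 1 = n + k + 1 := by lia
  have e2 : n + 1 + k - 1 = n + k := by lia
  rw [e1, e2]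
  have h := Nat.choose_mul_succ_eq (n + k) k
  have e3 : n + k + 1 - k = n + 1 := by lia
  rw [e3] at h
  have h' : ((n + k).choose k : ℝ) * (n + k + 1) = (n + k + 1).choose k * (n + 1) := by
    exact_mod_cast h
  push_cast
  linarith

lemma choose_index_succ {n : ℕ} (hn : 1 ≤ n) (k : ℕ) :
    ((k : ℝ) + 1) * (Nat.choose (n + (k + 1) - 1) (k + 1) : ℝ)
      = (n + k) * (Nat.choose (n + k - 1) k : ℝ) := by
  obtain ⟨n, rfl⟩ := Nat.exists_eq_add_of_le' hn
  have e1 : n + 1 + (k + 1) - 1 = n + k + 1 := by lia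
  have e2 : n + 1 + k - 1 = n + k := by lia
  rw [e1, e2]
  have h : ((n + k + 1 : ℕ) : ℝ) * ((n + k).choose k : ℝ) = (n + k + 1).choose (k + 1) * (k + 1) := by
    exact_mod_cast Nat.add_one_mul_choose_eq (n + k) k
  push_cast at h ⊢
  linarith

lemma P_weight_succ {n : ℕ} (hn : 1 ≤ n) (k : ℕ) {x : ℝ} (hx : 0 ≤ x) :
    (n : ℝ) * P (n + 1) k x = (n + k) * P n k x - (k + 1) * P n (k + 1 : ℕ) x := by
  have h1 := choose_weight_succ hn k
  have h2 := choose_index_succ hn k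
  have hx' : (1 + x) ≠ 0 := by positivity
  have hb : (n : ℝ) * P (n + 1) k x
      = (n * (Nat.choose (n + 1 + k - 1) k : ℝ)) * x ^ k * ((1 + x) ^ (n + 1 + k))⁻¹ := by
    rw [P_natCast]; ring
  have hc : ((k : ℝ) + 1) * P n (k + 1 : ℕ) x
      = ((k + 1) * (Nat.choose (n + (k + 1) - 1) (k + 1) : ℝ)) * x ^ (k + 1)
        * ((1 + x) ^ (n + (k + 1)))⁻¹ := by
    rw [P_natCast]; ring
  rw [hb, hc, h1, h2, P_natCast]
  have e1 : (1 + x) ^ (n + 1 + k) = (1 + x) ^ (n + k) * (1 + x) := by ring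
  have e2 : (1 + x) ^ (n + (k + 1)) = (1 + x) ^ (n + k) * (1 + x) := by ring
  rw [e1, e2]
  field_simp
  ring

lemma psi_mul_P {n : ℕ} (hn : 1 ≤ n) (k : ℕ) {x : ℝ} (hx : 0 ≤ x) :
    psi x * ((n : ℝ) * (n + 1) * P (n + 2) k x)
      = (n + (k + 1 : ℕ)) * (k + 1 : ℕ) * P n (k + 1 : ℕ) x := by
  have h1 := choose_weight_succ hn k
  have h2 := choose_index_succ hn k
  have h3 := choose_weight_succ (n := n + 1) (by lia) k
  have hx' : (1 + x) ≠ 0 := by positivity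
  have hb : psi x * ((n : ℝ) * (n + 1) * P (n + 2) k x)
      = (((n + 1 : ℕ) : ℝ) * (Nat.choose (n + 1 + 1 + k - 1) k : ℝ)) * n * psi x * x ^ k
        * ((1 + x) ^ (n + 2 + k))⁻¹ := by
    rw [P_natCast]; push_cast; ring
  have hc : ((n : ℝ) + (k + 1 : ℕ)) * (k + 1 : ℕ) * P n (k + 1 : ℕ) x
      = ((k + 1) * (Nat.choose (n + (k + 1) - 1) (k + 1) : ℝ)) * (n + k + 1) * x ^ (k + 1)
        * ((1 + x) ^ (n + (k + 1)))⁻¹ := by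
    rw [P_natCast]; push_cast; ring
  rw [hb, hc, h3, h2, ← h1]
  have e1 : (1 + x) ^ (n + 2 + k) = (1 + x) ^ (n + k) * (1 + x) ^ 2 := by ring
  have e2 : (1 + x) ^ (n + (k + 1)) = (1 + x) ^ (n + k) * (1 + x) := by ring
  rw [e1, e2, psi]
  push_cast
  field_simp
  ring

lemma hasDerivAt_P_zero (n : ℕ) {x : ℝ} (hx : -1 < x) :
    HasDerivAt (P n (0 : ℕ)) (-((n : ℝ) * P (n + 1) (0 : ℕ) x)) x := by
  have hx' : (1 + x) ≠ 0 := by linarith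
  have hf : P n (0 : ℕ) = fun y => ((1 + y) ^ n)⁻¹ := by
    ext y; rw [P_natCast]; simp
  rw [hf, P_natCast]
  refine HasDerivAt.congr_deriv
    (((((hasDerivAt_id x).const_add 1).pow n).inv (pow_ne_zero _ hx'))) ?_
  rcases n with _ | n
  · simp
  · simp only [id, Pi.pow_apply]
    push_cast
    simp
    field_simp
    ring

lemma hasDerivAt_P_succ {n : ℕ} (hn : 1 ≤ n) (k : ℕ) {x : ℝ} (hx : -1 < x) :
    HasDerivAt (P n (k + 1 : ℕ)) ((n : ℝ) * (P (n + 1) k x - P (n + 1) (k + 1 : ℕ) x)) x := by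
  have hx' : (1 + x) ≠ 0 := by linarith
  have hf : P n (k + 1 : ℕ) = fun y => (Nat.choose (n + (k + 1) - 1) (k + 1) : ℝ) *
      (y ^ (k + 1) * ((1 + y) ^ (n + (k + 1)))⁻¹) := by
    ext y; rw [P_natCast]; ring
  rw [hf]
  have h1 := choose_weight_succ hn k
  have h2 := choose_index_succ hn k
  have h3 := choose_weight_succ hn (k + 1)
  have hb : (n : ℝ) * (P (n + 1) k x - P (n + 1) (k + 1 : ℕ) x)
      = (n * (Nat.choose (n + 1 + k - 1) k : ℝ)) * x ^ k * ((1 + x) ^ (n + 1 + k))⁻¹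
      - (n * (Nat.choose (n + 1 + (k + 1) - 1) (k + 1) : ℝ)) * x ^ (k + 1)
        * ((1 + x) ^ (n + 1 + (k + 1)))⁻¹ := by
    rw [P_natCast, P_natCast]; ring
  rw [hb, h1, h3, ← h2]
  refine HasDerivAt.congr_deriv ((((hasDerivAt_id x).pow (k + 1)).mul
    ((((hasDerivAt_id x).const_add 1).pow (n + (k + 1))).inv (pow_ne_zero _ hx'))).const_mul
    (Nat.choose (n + (k + 1) - 1) (k + 1) : ℝ)) ?_
  have e1 : (1 + x) ^ (n + 1 + k) = (1 + x) ^ (n + k) * (1 + x) := by ring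
  have e2 : (1 + x) ^ (n + (k + 1)) = (1 + x) ^ (n + k) * (1 + x) := by ring
  have e3 : (1 + x) ^ (n + 1 + (k + 1)) = (1 + x) ^ (n + k) * (1 + x) ^ 2 := by ring
  simp only [Pi.pow_apply, Pi.inv_apply, id, e1, e2, e3]
  push_cast
  have e4 : n + (k + 1) - 1 = n + k := by lia
  simp only [e4]
  field_simp
  ring

lemma Dt_P {n : ℕ} (hn : 1 ≤ n) (k : ℕ) {x : ℝ} (hx : 0 ≤ x) :
    Dt (P n k) x = ((n : ℝ) + (k + 1 : ℕ)) * (k + 1 : ℕ) * P n (k + 1 : ℕ) x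
      - 2 * ((n + k) * k * P n k x) + (n + (k - 1 : ℕ)) * (k - 1 : ℕ) * P n (k - 1 : ℕ) x := by
  have hev : ∀ᶠ y in nhds x, -1 < y := Ioi_mem_nhds (by linarith)
  have hx1 : -1 < x := by linarith
  rcases k with _ | k
  · have h1 : deriv (P n (0 : ℕ)) =ᶠ[nhds x] fun y => -((n : ℝ) * P (n + 1) (0 : ℕ) y) := by
      filter_upwards [hev] with y hy using (hasDerivAt_P_zero n hy).deriv
    have h2 := ((hasDerivAt_P_zero (n + 1) hx1).const_mul (n : ℝ)).neg
    have h3 : Dt (P n (0 : ℕ)) x = psi x * ((n : ℝ) * (n + 1) * P (n + 2) (0 : ℕ) x) := by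
      rw [Dt, h1.deriv_eq]
      erw [h2.deriv]
      push_cast; ring
    rw [h3, psi_mul_P hn 0 hx]
    simp
  · have h1 : deriv (P n (k + 1 : ℕ)) =ᶠ[nhds x]
        fun y => (n : ℝ) * (P (n + 1) k y - P (n + 1) (k + 1 : ℕ) y) := by
      filter_upwards [hev] with y hy using (hasDerivAt_P_succ hn k hy).deriv
    have h2' := hasDerivAt_P_succ (n := n + 1) (by lia) k hx1
    rcases k with _ | k
    · have h2 := ((hasDerivAt_P_zero (n + 1) hx1).sub h2').const_mul (n : ℝ)
      have h3 : Dt (P n (0 + 1 : ℕ)) x = psi x * ((n : ℝ) * (n + 1) * P (n + 2) (0 + 1 : ℕ) x)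
          - 2 * (psi x * ((n : ℝ) * (n + 1) * P (n + 2) (0 : ℕ) x)) := by
        rw [Dt, h1.deriv_eq]
        erw [h2.deriv]
        push_cast; ring
      rw [h3, psi_mul_P hn _ hx, psi_mul_P hn _ hx]
      simp
    · have h2 := ((hasDerivAt_P_succ (n := n + 1) (by lia) k hx1).sub h2').const_mul (n : ℝ)
      have h3 : Dt (P n (k + 1 + 1 : ℕ)) x
          = psi x * ((n : ℝ) * (n + 1) * P (n + 2) (k + 1 + 1 : ℕ) x)
          - 2 * (psi x * ((n : ℝ) * (n + 1) * P (n + 2) (k + 1 : ℕ) x))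
          + psi x * ((n : ℝ) * (n + 1) * P (n + 2) k x) := by
        rw [Dt, h1.deriv_eq]
        erw [h2.deriv]
        push_cast; ring
      rw [h3, psi_mul_P hn _ hx, psi_mul_P hn _ hx, psi_mul_P hn _ hx]
      simp

lemma continuousOn_P (n k : ℕ) : ContinuousOn (P n k) (Ici 0) := by
  have hf : P n k = fun x => (Nat.choose (n + k - 1) k : ℝ) * x ^ k * ((1 + x) ^ (n + k))⁻¹ := by
    ext x; rw [P_natCast]
  rw [hf]
  refine ContinuousOn.mul (by fun_prop) (ContinuousOn.inv₀ (by fun_prop) fun x hx => ?_)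
  have : (0 : ℝ) ≤ x := hx
  positivity

lemma tendsto_P_atTop {n : ℕ} (hn : 1 ≤ n) (k : ℕ) : Tendsto (P n k) atTop (nhds 0) := by
  have hlim : Tendsto (fun x : ℝ => (Nat.choose (n + k - 1) k : ℝ) * (1 + x)⁻¹) atTop (nhds 0) := by
    simpa using (tendsto_inv_atTop_zero.comp
      (tendsto_atTop_add_const_left atTop (1 : ℝ) tendsto_id)).const_mul
        (Nat.choose (n + k - 1) k : ℝ)
  refine tendsto_of_tendsto_of_tendsto_of_le_of_le' tendsto_const_nhds hlim ?_ ?_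
  · filter_upwards [eventually_ge_atTop 0] with x hx using P_nonneg n k hx
  · filter_upwards [eventually_ge_atTop 0] with x hx
    rw [P_natCast, mul_assoc]
    gcongr
    have h1 : x ^ k * (1 + x) ≤ (1 + x) ^ (n + k) := by
      calc x ^ k * (1 + x) ≤ (1 + x) ^ k * (1 + x) ^ n := by
            gcongr
            · linarith
            · exact le_self_pow₀ (by linarith) (by lia)
        _ = _ := by ring
    rw [← div_eq_mul_inv, div_le_iff₀ (by positivity), inv_mul_eq_div, le_div_iff₀ (by positivity)]
    exact h1

lemma hasDerivAt_sum_P {n : ℕ} (hn : 1 ≤ n) (k : ℕ) {x : ℝ} (hx : -1 < x) :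
    HasDerivAt (fun y => ∑ i ∈ Finset.range (k + 1), P n i y) (-((n : ℝ) * P (n + 1) k x)) x := by
  induction k with
  | zero => simpa using hasDerivAt_P_zero n hx
  | succ k ih =>
    have h := ih.add (hasDerivAt_P_succ hn k hx)
    have e : (fun y => ∑ i ∈ Finset.range (k + 1 + 1), P n i y)
        = (fun y => ∑ i ∈ Finset.range (k + 1), P n i y) + P n (k + 1 : ℕ) := by
      ext y; rw [Finset.sum_range_succ]; rfl
    rw [e]
    exact h.congr_deriv (by ring)

lemma integral_P {n : ℕ} (hn : 1 ≤ n) (k : ℕ) :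
    IntegrableOn (P (n + 1) k) (Ioi 0) ∧ ∫ t in Ioi (0 : ℝ), P (n + 1) k t = 1 / n := by
  have hn0 : (n : ℝ) ≠ 0 := by positivity
  have hd : ∀ x ∈ Ici (0 : ℝ), HasDerivAt
      (fun y => -(1 / (n : ℝ)) * ∑ i ∈ Finset.range (k + 1), P n i y) (P (n + 1) k x) x := by
    intro x hx
    have hx : (0 : ℝ) ≤ x := hx
    refine ((hasDerivAt_sum_P hn k (by linarith)).const_mul (-(1 / (n : ℝ)))).congr_deriv ?_
    field_simp
  have hpos : ∀ x ∈ Ioi (0 : ℝ), 0 ≤ P (n + 1) k x := fun x hx => P_nonneg _ _ (le_of_lt hx)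
  have hlim : Tendsto (fun y => -(1 / (n : ℝ)) * ∑ i ∈ Finset.range (k + 1), P n i y) atTop
      (nhds 0) := by
    have h := (tendsto_finsetSum (Finset.range (k + 1))
      fun i _ => tendsto_P_atTop hn i).const_mul (-(1 / (n : ℝ)))
    simpa using h
  refine ⟨integrableOn_Ioi_deriv_of_nonneg' hd hpos hlim, ?_⟩
  rw [integral_Ioi_of_hasDerivAt_of_nonneg' hd hpos hlim]
  simp [P_zero_right]

end Basis

section Growth

/-- Sequences of at most polynomial growth. -/
def PolyGrowth (c : ℕ → ℝ) : Prop := ∃ C : ℝ, ∃ d : ℕ, ∀ k : ℕ, |c k| ≤ C * ((k : ℝ) + 1) ^ d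

/-- Bounded sequences. -/
def BddSeq (c : ℕ → ℝ) : Prop := ∃ C : ℝ, ∀ k : ℕ, |c k| ≤ C

lemma BddSeq.polyGrowth {c : ℕ → ℝ} (hc : BddSeq c) : PolyGrowth c := by
  obtain ⟨C, hC⟩ := hc
  exact ⟨C, 0, fun k => by simpa using hC k⟩

lemma BddSeq.add {c d : ℕ → ℝ} (hc : BddSeq c) (hd : BddSeq d) : BddSeq (c + d) := by
  obtain ⟨C, hC⟩ := hc
  obtain ⟨D, hD⟩ := hd
  exact ⟨C + D, fun k => (abs_add_le _ _).trans (add_le_add (hC k) (hD k))⟩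

lemma BddSeq.smul {c : ℕ → ℝ} (r : ℝ) (hc : BddSeq c) : BddSeq (r • c) := by
  obtain ⟨C, hC⟩ := hc
  refine ⟨|r| * C, fun k => ?_⟩
  rw [Pi.smul_apply, smul_eq_mul, abs_mul]
  exact mul_le_mul_of_nonneg_left (hC k) (abs_nonneg r)

lemma BddSeq.of_shift {c : ℕ → ℝ} (i : ℕ) (hc : BddSeq fun k => c (k + i)) : BddSeq c := by
  induction i generalizing c with
  | zero => simpa using hc
  | succ i ih =>
    obtain ⟨C, hC⟩ := ih (c := fun k => c (k + 1)) (by simpa only [add_assoc] using hc)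
    refine ⟨max |c 0| C, fun k => ?_⟩
    rcases k with _ | k
    · exact le_max_left _ _
    · exact (hC k).trans (le_max_right _ _)

lemma PolyGrowth.add {c d : ℕ → ℝ} (hc : PolyGrowth c) (hd : PolyGrowth d) :
    PolyGrowth (fun k => c k + d k) := by
  obtain ⟨C, p, hC⟩ := hc
  obtain ⟨D, q, hD⟩ := hd
  refine ⟨|C| + |D|, p + q, fun k => ?_⟩
  have h1 : (1 : ℝ) ≤ k + 1 := by linarith [k.cast_nonneg (α := ℝ)]
  have hp : ((k : ℝ) + 1) ^ p ≤ (k + 1) ^ (p + q) := pow_le_pow_right₀ h1 (by lia)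
  have hq : ((k : ℝ) + 1) ^ q ≤ (k + 1) ^ (p + q) := pow_le_pow_right₀ h1 (by lia)
  calc |c k + d k| ≤ |c k| + |d k| := abs_add_le _ _
    _ ≤ C * (k + 1) ^ p + D * (k + 1) ^ q := add_le_add (hC k) (hD k)
    _ ≤ |C| * (k + 1) ^ (p + q) + |D| * (k + 1) ^ (p + q) := by
        gcongr
        · exact le_abs_self C
        · exact le_abs_self D
    _ = _ := by ring

lemma PolyGrowth.mul {c d : ℕ → ℝ} (hc : PolyGrowth c) (hd : PolyGrowth d) :
    PolyGrowth (fun k => c k * d k) := by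
  obtain ⟨C, p, hC⟩ := hc
  obtain ⟨D, q, hD⟩ := hd
  refine ⟨C * D, p + q, fun k => ?_⟩
  rw [abs_mul]
  calc |c k| * |d k| ≤ (C * (k + 1) ^ p) * (D * (k + 1) ^ q) :=
        mul_le_mul (hC k) (hD k) (abs_nonneg _) ((abs_nonneg _).trans (hC k))
    _ = _ := by ring

lemma polyGrowth_const (r : ℝ) : PolyGrowth fun _ => r := ⟨|r|, 0, fun _ => by simp⟩

lemma polyGrowth_natCast : PolyGrowth fun k => (k : ℝ) :=
  ⟨1, 1, fun k => by rw [abs_of_nonneg k.cast_nonneg]; linarith⟩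

lemma PolyGrowth.sub {c d : ℕ → ℝ} (hc : PolyGrowth c) (hd : PolyGrowth d) :
    PolyGrowth (fun k => c k - d k) := by
  convert hc.add ((polyGrowth_const (-1)).mul hd) using 2
  ring

lemma PolyGrowth.succ {c : ℕ → ℝ} (hc : PolyGrowth c) : PolyGrowth (fun k => c (k + 1)) := by
  obtain ⟨C, p, hC⟩ := hc
  refine ⟨|C| * 2 ^ p, p, fun k => (hC (k + 1)).trans ?_⟩
  have hk := k.cast_nonneg (α := ℝ)
  calc C * (((k + 1 : ℕ) : ℝ) + 1) ^ p ≤ |C| * (2 * (k + 1)) ^ p := by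
        gcongr
        · exact le_abs_self C
        · push_cast; linarith
    _ = _ := by rw [mul_pow]; ring

lemma PolyGrowth.pred {c : ℕ → ℝ} (hc : PolyGrowth c) : PolyGrowth (fun k => c (k - 1)) := by
  obtain ⟨C, p, hC⟩ := hc
  refine ⟨|C|, p, fun k => (hC (k - 1)).trans ?_⟩
  gcongr
  · exact le_abs_self C
  · exact Nat.sub_le k 1

lemma summable_succ_pow_mul_geometric (d : ℕ) {y : ℝ} (hy : 0 ≤ y) (hy1 : y < 1) :
    Summable fun k : ℕ => ((k : ℝ) + 1) ^ d * y ^ k := by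
  have hn : ‖y‖ < 1 := by rwa [Real.norm_of_nonneg hy]
  have h1 := (summable_pow_mul_geometric_of_norm_lt_one d hn).add
    (summable_pow_mul_geometric_of_norm_lt_one 0 hn)
  refine Summable.of_nonneg_of_le (fun k => by positivity) (fun k => ?_) (h1.mul_left ((2 : ℝ) ^ d))
  rw [← add_mul, ← mul_assoc]
  gcongr
  rcases k with _ | k
  · simp only [Nat.cast_zero, zero_add, one_pow, pow_zero]
    have : (1 : ℝ) ≤ 2 ^ d := one_le_pow₀ (by norm_num)
    have : (0 : ℝ) ≤ 0 ^ d := by positivity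
    nlinarith
  · have hk := k.cast_nonneg (α := ℝ)
    calc (((k + 1 : ℕ) : ℝ) + 1) ^ d ≤ (2 * ((k + 1 : ℕ) : ℝ)) ^ d := by
          gcongr
          push_cast; linarith
      _ = 2 ^ d * ((k + 1 : ℕ) : ℝ) ^ d := mul_pow _ _ _
      _ ≤ _ := by gcongr; simp

lemma tsum_mul_shift {c w : ℕ → ℝ} (hw : w 0 = 0) (h : Summable fun k => c (k - 1) * w k) :
    (Summable fun k => c k * w (k + 1)) ∧ ∑' k, c k * w (k + 1) = ∑' k, c (k - 1) * w k := by
  refine ⟨by simpa using (summable_nat_add_iff 1).2 h, ?_⟩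
  rw [h.tsum_eq_zero_add]
  simp [hw]

lemma tsum_mul_shift_pred {c w : ℕ → ℝ} (hw : w 0 = 0) (h : Summable fun k => c (k + 1) * w k) :
    (Summable fun k => c k * w (k - 1)) ∧ ∑' k, c k * w (k - 1) = ∑' k, c (k + 1) * w k := by
  have hs : Summable fun k => c k * w (k - 1) := (summable_nat_add_iff 1).1 (by simpa using h)
  refine ⟨hs, ?_⟩
  rw [hs.tsum_eq_zero_add]
  simp [hw]

end Growth

section Synthesis

/-- The series `∑ c_k P_{n,k}(x)`. -/
noncomputable def synth (n : ℕ) (c : ℕ → ℝ) (x : ℝ) : ℝ := ∑' k : ℕ, c k * P n k x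

/-- The action of `D̃` on coefficients with respect to the basis `P_{n,k}`. -/
noncomputable def diffOp (n : ℕ) : Module.End ℝ (ℕ → ℝ) where
  toFun c k := (n + k) * k * (c (k + 1) - 2 * c k + c (k - 1))
  map_add' c d := by ext k; simp only [Pi.add_apply]; ring
  map_smul' r c := by ext k; simp only [Pi.smul_apply, smul_eq_mul, RingHom.id_apply]; ring

/-- Change of coefficients from the basis `P_{n+1,k}` to the basis `P_{n,k}`. -/
noncomputable def lowerOp (n : ℕ) : Module.End ℝ (ℕ → ℝ) where
  toFun c k := ((n + k) * c k - k * c (k - 1)) / n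
  map_add' c d := by ext k; simp only [Pi.add_apply]; ring
  map_smul' r c := by ext k; simp only [Pi.smul_apply, smul_eq_mul, RingHom.id_apply]; ring

/-- Passage from the functionals `v_{n,k}` to the functionals `v_{n+1,k}`. -/
noncomputable def raiseOp (n : ℕ) : Module.End ℝ (ℕ → ℝ) where
  toFun c k := ((n + 1 + k) * c k - k * c (k + 1)) / (n + 1)
  map_add' c d := by ext k; simp only [Pi.add_apply]; ring
  map_smul' r c := by ext k; simp only [Pi.smul_apply, smul_eq_mul, RingHom.id_apply]; ring

lemma diffOp_apply (n : ℕ) (c : ℕ → ℝ) (k : ℕ) :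
    diffOp n c k = (n + k) * k * (c (k + 1) - 2 * c k + c (k - 1)) := rfl

lemma lowerOp_apply (n : ℕ) (c : ℕ → ℝ) (k : ℕ) :
    lowerOp n c k = ((n + k) * c k - k * c (k - 1)) / n := rfl

lemma raiseOp_apply (n : ℕ) (c : ℕ → ℝ) (k : ℕ) :
    raiseOp n c k = ((n + 1 + k) * c k - k * c (k + 1)) / (n + 1) := rfl

lemma PolyGrowth.diffOp {c : ℕ → ℝ} (hc : PolyGrowth c) (n : ℕ) : PolyGrowth (diffOp n c) :=
  ((((polyGrowth_const n).add polyGrowth_natCast).mul polyGrowth_natCast).mul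
    ((hc.succ.sub ((polyGrowth_const 2).mul hc)).add hc.pred))

lemma PolyGrowth.lowerOp {c : ℕ → ℝ} (hc : PolyGrowth c) (n : ℕ) : PolyGrowth (lowerOp n c) := by
  show PolyGrowth fun k => ((n + k) * c k - k * c (k - 1)) / (n : ℝ)
  simpa only [div_eq_mul_inv] using
    ((((polyGrowth_const n).add polyGrowth_natCast).mul hc).sub (polyGrowth_natCast.mul hc.pred)).mul
      (polyGrowth_const (n : ℝ)⁻¹)

lemma PolyGrowth.aeval_diffOp (n : ℕ) (q : Polynomial ℝ) {c : ℕ → ℝ} (hc : PolyGrowth c) :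
    PolyGrowth (Polynomial.aeval (_root_.diffOp n) q c) := by
  induction q using Polynomial.induction_on generalizing c with
  | C a =>
    rw [Polynomial.aeval_C, Module.algebraMap_end_apply]
    exact (polyGrowth_const a).mul hc
  | add p q hp hq =>
    rw [map_add]
    exact (hp hc).add (hq hc)
  | monomial m a ih =>
    rw [pow_succ, ← mul_assoc, map_mul, Polynomial.aeval_X, Module.End.mul_apply]
    exact ih (hc.diffOp n)

lemma lowerOp_mul_raiseOp {n : ℕ} (hn : 1 ≤ n) :
    lowerOp n * raiseOp n = 1 - (1 / ((n : ℝ) * (n + 1))) • diffOp n := by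
  have hn0 : (n : ℝ) ≠ 0 := by positivity
  have hn1 : (n : ℝ) + 1 ≠ 0 := by positivity
  refine LinearMap.ext fun c => funext fun k => ?_
  simp only [Module.End.mul_apply, LinearMap.sub_apply, Module.End.one_apply,
    LinearMap.smul_apply, Pi.sub_apply, Pi.smul_apply, smul_eq_mul, lowerOp_apply, raiseOp_apply,
    diffOp_apply]
  rcases k with _ | k
  · simp; field_simp
  · simp only [Nat.add_sub_cancel]
    push_cast
    field_simp
    ring

lemma lowerOp_mul_diffOp (n : ℕ) :
    lowerOp n * diffOp (n + 1) = diffOp n * lowerOp n := by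
  refine LinearMap.ext fun c => funext fun k => ?_
  simp only [Module.End.mul_apply, lowerOp_apply, diffOp_apply]
  rcases k with _ | _ | k
  · simp
  · simp; ring
  · simp only [Nat.add_sub_cancel]
    push_cast
    ring

lemma lowerOp_mul_aeval (n : ℕ) (q : Polynomial ℝ) :
    lowerOp n * Polynomial.aeval (diffOp (n + 1)) q
      = Polynomial.aeval (diffOp n) q * lowerOp n := by
  induction q using Polynomial.induction_on with
  | C a => simpa using (Algebra.commutes a (lowerOp n)).symm
  | add p q hp hq => simp only [map_add, mul_add, add_mul, hp, hq]
  | monomial m a ih =>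
    rw [pow_succ, ← mul_assoc, map_mul _ _ Polynomial.X, map_mul _ _ Polynomial.X,
      Polynomial.aeval_X, Polynomial.aeval_X, ← mul_assoc, ih, mul_assoc, lowerOp_mul_diffOp,
      mul_assoc]

lemma summable_mul_P {n : ℕ} (hn : 1 ≤ n) {c : ℕ → ℝ} (hc : PolyGrowth c) {x : ℝ} (hx : 0 ≤ x) :
    Summable fun k : ℕ => c k * P n k x := by
  induction n, hn using Nat.le_induction generalizing c with
  | base =>
    obtain ⟨C, d, hC⟩ := hc
    have hy : x / (1 + x) < 1 := by rw [div_lt_one (by linarith)]; linarith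
    refine Summable.of_norm_bounded
      ((summable_succ_pow_mul_geometric d (by positivity) hy).mul_left (C * (1 + x)⁻¹)) fun k => ?_
    rw [Real.norm_eq_abs, abs_mul, abs_of_nonneg (P_nonneg 1 k hx), P_one]
    calc |c k| * (x ^ k * ((1 + x) ^ (1 + k))⁻¹)
        ≤ (C * ((k : ℝ) + 1) ^ d) * (x ^ k * ((1 + x) ^ (1 + k))⁻¹) := by
          gcongr; exact hC k
      _ = _ := by rw [pow_add, div_pow]; field_simp
  | succ n hn ih =>
    have h1 := ih (((polyGrowth_const n).add polyGrowth_natCast).mul hc)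
    have h2 := (tsum_mul_shift (c := c) (w := fun k => k * P n k x) (by simp)
      (by convert ih (hc.pred.mul polyGrowth_natCast) using 2; ring)).1
    refine ((h1.sub h2).mul_left (1 / (n : ℝ))).congr fun k => ?_
    have hn0 : (n : ℝ) ≠ 0 := by positivity
    have h := P_weight_succ hn k hx
    push_cast at h ⊢
    field_simp
    linear_combination -c k * h

lemma synth_succ {n : ℕ} (hn : 1 ≤ n) {c : ℕ → ℝ} (hc : PolyGrowth c) {x : ℝ} (hx : 0 ≤ x) :
    synth (n + 1) c x = synth n (lowerOp n c) x := by
  have h1 := summable_mul_P hn (((polyGrowth_const n).add polyGrowth_natCast).mul hc) hx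
  have h2' : Summable fun k : ℕ => c (k - 1) * (k * P n k x) := by
    convert summable_mul_P hn (hc.pred.mul polyGrowth_natCast) hx using 2; ring
  have h2 := tsum_mul_shift (c := c) (w := fun k => k * P n k x) (by simp) h2'
  have hn0 : (n : ℝ) ≠ 0 := by positivity
  calc synth (n + 1) c x
      = ∑' k : ℕ, 1 / (n : ℝ) * ((n + k) * c k * P n k x
          - c k * ((k + 1 : ℕ) * P n (k + 1 : ℕ) x)) := by
        refine tsum_congr fun k => ?_
        have h := P_weight_succ hn k hx
        push_cast at h ⊢
        field_simp
        linear_combination c k * h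
    _ = 1 / (n : ℝ) * (∑' k : ℕ, (n + k) * c k * P n k x
          - ∑' k : ℕ, c (k - 1) * (k * P n k x)) := by
        rw [tsum_mul_left, h1.tsum_sub h2.1, h2.2]
    _ = synth n (lowerOp n c) x := by
        rw [← h1.tsum_sub h2', ← tsum_mul_left]
        refine tsum_congr fun k => ?_
        rw [lowerOp_apply]
        field_simp

lemma tsum_mul_Dt_P {n : ℕ} (hn : 1 ≤ n) {c : ℕ → ℝ} (hc : PolyGrowth c) {x : ℝ} (hx : 0 ≤ x) :
    (Summable fun k : ℕ => c k * Dt (P n k) x) ∧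
      ∑' k : ℕ, c k * Dt (P n k) x = synth n (diffOp n c) x := by
  set w : ℕ → ℝ := fun k => (n + k) * k * P n k x with hw
  have hs : ∀ {d : ℕ → ℝ}, PolyGrowth d → Summable fun k => d k * w k := by
    intro d hd
    convert summable_mul_P hn (hd.mul (((polyGrowth_const n).add polyGrowth_natCast).mul
      polyGrowth_natCast)) hx using 2
    simp only [hw]; ring
  have hw0 : w 0 = 0 := by simp [hw]
  obtain ⟨s1, e1⟩ := tsum_mul_shift hw0 (hs hc.pred)
  obtain ⟨s3, e3⟩ := tsum_mul_shift_pred hw0 (hs hc.succ)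
  have s2 := (hs hc).mul_left 2
  have hterm : (fun k : ℕ => c k * Dt (P n k) x)
      = fun k => c k * w (k + 1) - 2 * (c k * w k) + c k * w (k - 1) := by
    ext k
    rw [Dt_P hn k hx]
    simp only [hw]
    ring
  rw [hterm]
  refine ⟨(s1.sub s2).add s3, ?_⟩
  rw [(s1.sub s2).tsum_add s3, s1.tsum_sub s2, e1, e3, ← (hs hc.pred).tsum_sub s2,
    ← ((hs hc.pred).sub s2).tsum_add (hs hc.succ)]
  refine tsum_congr fun k => ?_
  simp only [hw, diffOp_apply]
  ring

lemma Vt_eq_synth {n : ℕ} (hn : 1 ≤ n) {f : ℝ → ℝ} (hf : PolyGrowth fun k => v n k f) {x : ℝ}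
    (hx : 0 ≤ x) :
    Vt n f x = synth n (Polynomial.aeval (diffOp n)
      (1 - Polynomial.C (1 / (n : ℝ)) * Polynomial.X) fun k => v n k f) x := by
  obtain ⟨s, e⟩ := tsum_mul_Dt_P hn hf hx
  have s1 := summable_mul_P hn hf hx
  have s2 := summable_mul_P hn (hf.diffOp n) hx
  have h1 : Vt n f x = ∑' k : ℕ, v n k f * P n k x - 1 / n * synth n (diffOp n fun k => v n k f) x := by
    rw [← e, ← tsum_mul_left, ← s1.tsum_sub (s.mul_left _)]
    exact tsum_congr fun k => by ring
  rw [h1, synth, synth, ← tsum_mul_left, ← s1.tsum_sub (s2.mul_left _)]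
  refine tsum_congr fun k => ?_
  simp [Module.algebraMap_end_apply]
  ring

lemma exists_synth_one_eq {n : ℕ} (hn : 1 ≤ n) (q : Polynomial ℝ) :
    ∃ r : Polynomial ℝ, ∀ a : ℕ → ℕ → ℝ, (∀ i, 1 ≤ i → a (i + 1) = raiseOp i (a i)) →
      (∀ i, 1 ≤ i → PolyGrowth (a i)) → ∀ x : ℝ, 0 ≤ x →
      synth n (Polynomial.aeval (diffOp n) q (a n)) x
        = synth 1 (Polynomial.aeval (diffOp 1) r (a 1)) x := by
  induction n, hn using Nat.le_induction generalizing q with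
  | base => exact ⟨q, fun _ _ _ _ _ => rfl⟩
  | succ n hn ih =>
    obtain ⟨r, hr⟩ := ih (q * (1 - Polynomial.C (1 / ((n : ℝ) * (n + 1))) * Polynomial.X))
    refine ⟨r, fun a ha hg x hx => ?_⟩
    rw [← hr a ha hg x hx, synth_succ hn ((hg (n + 1) (by lia)).aeval_diffOp (n + 1) q) hx,
      ha n hn]
    congr 1
    have h : lowerOp n * Polynomial.aeval (diffOp (n + 1)) q * raiseOp n
        = Polynomial.aeval (diffOp n)
          (q * (1 - Polynomial.C (1 / ((n : ℝ) * (n + 1))) * Polynomial.X)) := by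
      rw [lowerOp_mul_aeval, mul_assoc, lowerOp_mul_raiseOp hn, map_mul]
      simp [Algebra.smul_def]
    rw [← h]
    rfl

end Synthesis

section Tame

/-- Sequences whose iterated images under `diffOp 1` are all bounded. -/
def Tame (c : ℕ → ℝ) : Prop := ∀ j : ℕ, BddSeq ((diffOp 1 ^ j) c)

lemma Tame.bddSeq {c : ℕ → ℝ} (hc : Tame c) : BddSeq c := hc 0

lemma Tame.diffOp {c : ℕ → ℝ} (hc : Tame c) : Tame (diffOp 1 c) := fun j => hc (j + 1)

lemma Tame.aeval {c : ℕ → ℝ} (hc : Tame c) (q : Polynomial ℝ) :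
    Tame (Polynomial.aeval (_root_.diffOp 1) q c) := by
  induction q using Polynomial.induction_on generalizing c with
  | C a =>
    intro j
    rw [Polynomial.aeval_C, Module.algebraMap_end_apply, map_smul]
    exact (hc j).smul a
  | add p q hp hq =>
    intro j
    rw [map_add, LinearMap.add_apply, map_add]
    exact (hp hc j).add (hq hc j)
  | monomial m a ih =>
    rw [pow_succ, ← mul_assoc, map_mul, Polynomial.aeval_X, Module.End.mul_apply]
    exact ih hc.diffOp

/-- The shift on sequences. -/
def shiftOp : Module.End ℝ (ℕ → ℝ) where
  toFun c k := c (k + 1)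
  map_add' _ _ := rfl
  map_smul' _ _ := rfl

/-- The operator `k ↦ k (c_{k+1} - c_k)` on sequences. -/
def eulerOp : Module.End ℝ (ℕ → ℝ) where
  toFun c k := k * (c (k + 1) - c k)
  map_add' c d := by ext k; simp only [Pi.add_apply]; ring
  map_smul' r c := by ext k; simp only [Pi.smul_apply, smul_eq_mul, RingHom.id_apply]; ring

lemma bddSeq_of_mem_span {s : Set (ℕ → ℝ)} (hs : ∀ c ∈ s, BddSeq c) {c : ℕ → ℝ}
    (hc : c ∈ Submodule.span ℝ s) : BddSeq c := by
  induction hc using Submodule.span_induction with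
  | mem c h => exact hs c h
  | zero => exact ⟨0, fun _ => by simp⟩
  | add c d _ _ hc hd => exact hc.add hd
  | smul r c _ hc => exact hc.smul r

lemma shift_diffOp_mem {W : Submodule ℝ (ℕ → ℝ)} (hS : ∀ c ∈ W, shiftOp c ∈ W)
    (hE : ∀ c ∈ W, eulerOp c ∈ W) {c : ℕ → ℝ} {i : ℕ} (hc : (fun k => c (k + i)) ∈ W) :
    (fun k => diffOp 1 c (k + (i + 1))) ∈ W := by
  set b : ℕ → ℝ := fun k => c (k + i) with hb
  have hD : shiftOp b - b ∈ W := W.sub_mem (hS _ hc) hc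
  have hDD := W.sub_mem (hS _ hD) hD
  have h1 := hE _ hD
  have h2 := W.sub_mem (W.sub_mem (hE _ (hE _ hc)) (hE _ hc)) h1
  convert W.add_mem (W.add_mem h2 (W.smul_mem (2 * (i : ℝ) + 3) h1))
    (W.smul_mem (((i : ℝ) + 1) * (i + 2)) hDD) using 1
  ext k
  have e1 : k + (i + 1) + 1 = k + 1 + 1 + i := by ring
  have e2 : k + (i + 1) = k + 1 + i := by ring
  have e3 : k + (i + 1) - 1 = k + i := by lia
  simp only [diffOp_apply, e3, e1, Pi.add_apply, Pi.sub_apply, Pi.smul_apply, smul_eq_mul,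
    shiftOp, eulerOp, LinearMap.coe_mk, AddHom.coe_mk, hb]
  rw [e2]
  push_cast
  ring

lemma tame_of_raiseOp {a : ℕ → ℕ → ℝ} (ha : ∀ i, 1 ≤ i → a (i + 1) = raiseOp i (a i))
    (hb : ∀ i, 1 ≤ i → BddSeq (a i)) : Tame (a 1) := by
  set G : ℕ × ℕ → ℕ → ℝ := fun p k => a (p.1 + 1) (k + p.2) with hG
  set W := Submodule.span ℝ (range G) with hW
  have hGW : ∀ p, G p ∈ W := fun p => Submodule.subset_span ⟨p, rfl⟩
  have hS : ∀ c ∈ W, shiftOp c ∈ W := by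
    have : W ≤ W.comap shiftOp := by
      rw [hW, Submodule.span_le]
      rintro _ ⟨⟨n, i⟩, rfl⟩
      show shiftOp (G (n, i)) ∈ W
      convert hGW (n, i + 1) using 1
      ext k
      simp only [hG, shiftOp, LinearMap.coe_mk, AddHom.coe_mk]
      congr 1
      ring
    exact this
  have hE : ∀ c ∈ W, eulerOp c ∈ W := by
    have : W ≤ W.comap eulerOp := by
      rw [hW, Submodule.span_le]
      rintro _ ⟨⟨n, i⟩, rfl⟩
      show eulerOp (G (n, i)) ∈ W
      convert W.sub_mem (W.smul_mem ((n : ℝ) + 2) (W.sub_mem (hGW (n, i)) (hGW (n + 1, i))))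
        (W.smul_mem (i : ℝ) (W.sub_mem (hGW (n, i + 1)) (hGW (n, i)))) using 1
      ext k
      have e1 : k + 1 + i = k + i + 1 := by ring
      have e2 : k + (i + 1) = k + i + 1 := by ring
      simp only [hG, eulerOp, LinearMap.coe_mk, AddHom.coe_mk, Pi.sub_apply, Pi.smul_apply,
        smul_eq_mul, ha (n + 1) (by lia), raiseOp_apply, e1, e2]
      have hn : ((n + 1 : ℕ) : ℝ) + 1 ≠ 0 := by positivity
      push_cast at hn ⊢
      field_simp
      ring
    exact this
  have hbdd : ∀ c ∈ W, BddSeq c := by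
    refine fun c hc => bddSeq_of_mem_span ?_ hc
    rintro _ ⟨⟨n, i⟩, rfl⟩
    obtain ⟨C, hC⟩ := hb (n + 1) (by lia)
    exact ⟨C, fun k => hC _⟩
  intro j
  refine BddSeq.of_shift j (hbdd _ ?_)
  induction j with
  | zero => exact hGW (0, 0)
  | succ j ih =>
    rw [pow_succ']
    exact shift_diffOp_mem hS hE ih

end Tame

section Kernel

/-- The matrix entries `v_{1,k}(P_{1,j})`. -/
noncomputable def kernel (k j : ℕ) : ℝ :=
  if k = 0 then (if j = 0 then 1 else 0)
  else k * (k + 1) * 2 / ((k + j) * (k + j + 1) * (k + j + 2))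

/-- The operator with matrix `kernel`. -/
noncomputable def kernelOp (c : ℕ → ℝ) (k : ℕ) : ℝ := ∑' j : ℕ, kernel k j * c j

lemma summable_kernel (k : ℕ) : Summable (kernel k) := by
  rcases k with _ | k
  · exact summable_of_ne_finset_zero (s := {0}) fun j hj => by
      have : j ≠ 0 := by simpa using hj
      simp [kernel, this]
  · have h := (summable_nat_add_iff 1).2 (Real.summable_one_div_nat_pow.2 (by norm_num : 1 < 2))
    refine Summable.of_nonneg_of_le (fun j => ?_) (fun j => ?_)
      (h.mul_left (((k + 1 : ℕ) : ℝ) * ((k + 1 : ℕ) + 1) * 2))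
    · simp only [kernel, Nat.succ_ne_zero, if_false]; positivity
    · simp only [kernel, Nat.succ_ne_zero, if_false]
      rw [mul_one_div]
      gcongr
      have hk := k.cast_nonneg (α := ℝ)
      have hj := j.cast_nonneg (α := ℝ)
      push_cast
      have h1 : (j : ℝ) + 1 ≤ k + 1 + j := by linarith
      have h2 : (j : ℝ) + 1 ≤ k + 1 + j + 1 := by linarith
      have h3 : (1 : ℝ) ≤ k + 1 + j + 2 := by linarith
      calc ((j : ℝ) + 1) ^ 2 = (j + 1) * (j + 1) * 1 := by ring
        _ ≤ _ := by gcongr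

lemma kernel_nonneg (k j : ℕ) : 0 ≤ kernel k j := by
  unfold kernel
  split_ifs <;> positivity

lemma summable_kernel_mul (k : ℕ) {c : ℕ → ℝ} (hc : BddSeq c) :
    Summable fun j => kernel k j * c j := by
  obtain ⟨C, hC⟩ := hc
  refine Summable.of_norm_bounded ((summable_kernel k).mul_right C) fun j => ?_
  rw [Real.norm_eq_abs, abs_mul, abs_of_nonneg (kernel_nonneg k j)]
  exact mul_le_mul_of_nonneg_left (hC j) (kernel_nonneg k j)

lemma kernelOp_zero (c : ℕ → ℝ) : kernelOp c 0 = c 0 := by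
  rw [kernelOp, tsum_eq_single 0 fun j hj => by simp [kernel, hj]]
  simp [kernel]

lemma kernelOp_add {c d : ℕ → ℝ} (hc : BddSeq c) (hd : BddSeq d) :
    kernelOp (c + d) = kernelOp c + kernelOp d := by
  ext k
  rw [Pi.add_apply, kernelOp, kernelOp, kernelOp,
    ← (summable_kernel_mul k hc).tsum_add (summable_kernel_mul k hd)]
  exact tsum_congr fun j => by rw [Pi.add_apply]; ring

lemma kernelOp_smul (r : ℝ) (c : ℕ → ℝ) : kernelOp (r • c) = r • kernelOp c := by
  ext k
  rw [Pi.smul_apply, kernelOp, kernelOp, smul_eq_mul, ← tsum_mul_left]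
  exact tsum_congr fun j => by rw [Pi.smul_apply, smul_eq_mul]; ring

lemma sum_kernel_diffOp (c : ℕ → ℝ) (k N : ℕ) :
    ∑ j ∈ Finset.range (N + 1), (kernel (k + 1) j * diffOp 1 c j
        - ((1 : ℕ) + (k + 1 : ℕ)) * (k + 1 : ℕ)
          * (kernel (k + 2) j * c j - 2 * (kernel (k + 1) j * c j) + kernel k j * c j))
      = N * (N + 1) * kernel (k + 1) N * c (N + 1)
        - (N + 1) * (N + 2) * kernel (k + 1) (N + 1) * c N := by
  induction N with
  | zero =>
    have hk := k.cast_nonneg (α := ℝ)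
    rcases k with _ | k
    · simp [kernel, diffOp_apply]
      ring
    · simp [kernel, diffOp_apply]
      field_simp
      ring
  | succ N ih =>
    rw [Finset.sum_range_succ, ih]
    have hk := k.cast_nonneg (α := ℝ)
    have hN := N.cast_nonneg (α := ℝ)
    rcases k with _ | k
    · simp [kernel, diffOp_apply]
      field_simp
      ring
    · simp [kernel, diffOp_apply]
      field_simp
      ring

lemma kernel_succ_le (k j : ℕ) :
    (j : ℝ) * (j + 1) * kernel (k + 1) j ≤ (k + 1) * (k + 2) * 2 / (j + 1) := by
  have hk := k.cast_nonneg (α := ℝ)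
  have hj := j.cast_nonneg (α := ℝ)
  simp only [kernel, Nat.succ_ne_zero, if_false]
  push_cast
  rw [mul_div_assoc', div_le_div_iff₀ (by positivity) (by positivity)]
  have h1 : (j : ℝ) ≤ k + 1 + j := by linarith
  have h2 : (j : ℝ) + 1 ≤ k + 1 + j + 1 := by linarith
  have h3 : (j : ℝ) + 1 ≤ k + 1 + j + 2 := by linarith
  calc (j : ℝ) * (j + 1) * ((k + 1) * (k + 1 + 1) * 2) * (j + 1)
      = (k + 1) * (k + 2) * 2 * (j * (j + 1) * (j + 1)) := by ring
    _ ≤ _ := by gcongr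

lemma kernelOp_diffOp {c : ℕ → ℝ} (hc : BddSeq c) (hLc : BddSeq (diffOp 1 c)) :
    kernelOp (diffOp 1 c) = diffOp 1 (kernelOp c) := by
  ext k
  rcases k with _ | k
  · rw [kernelOp_zero]; simp [diffOp_apply]
  have s0 := summable_kernel_mul (k + 1) hLc
  have s1 := summable_kernel_mul (k + 2) hc
  have s2 := (summable_kernel_mul (k + 1) hc).mul_left 2
  have s3 := summable_kernel_mul k hc
  have S := s0.sub (((s1.sub s2).add s3).mul_left ((((1 : ℕ) : ℝ) + (k + 1 : ℕ)) * (k + 1 : ℕ)))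
  have hlim : Tendsto (fun N : ℕ => (N : ℝ) * (N + 1) * kernel (k + 1) N * c (N + 1)
        - (N + 1) * (N + 2) * kernel (k + 1) (N + 1) * c N) atTop (nhds 0) := by
    obtain ⟨C, hC⟩ := hc
    have hC0 : 0 ≤ C := (abs_nonneg _).trans (hC 0)
    have hb := (tendsto_one_div_add_atTop_nhds_zero_nat (𝕜 := ℝ)).const_mul
      (2 * (((k : ℝ) + 1) * (k + 2) * 2 * C))
    rw [mul_zero] at hb
    refine squeeze_zero_norm (fun N => ?_) hb
    have h1 := kernel_succ_le k N
    have h2 := kernel_succ_le k (N + 1)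
    have h3 : ((k : ℝ) + 1) * (k + 2) * 2 / ((N + 1 : ℕ) + 1) ≤ (k + 1) * (k + 2) * 2 / (N + 1) := by
      gcongr; simp
    have p1 : 0 ≤ (N : ℝ) * (N + 1) * kernel (k + 1) N :=
      mul_nonneg (by positivity) (kernel_nonneg _ _)
    have p2 : 0 ≤ ((N : ℝ) + 1) * (N + 2) * kernel (k + 1) (N + 1) :=
      mul_nonneg (by positivity) (kernel_nonneg _ _)
    have h4 : ((N : ℝ) + 1) * (N + 2) * kernel (k + 1) (N + 1)
        ≤ (k + 1) * (k + 2) * 2 / (N + 1) := by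
      refine le_trans (le_of_eq ?_) (h2.trans h3)
      push_cast; ring
    rw [Real.norm_eq_abs]
    refine (abs_sub _ _).trans ?_
    rw [abs_mul, abs_mul _ (c N), abs_of_nonneg p1, abs_of_nonneg p2]
    calc _ ≤ ((k : ℝ) + 1) * (k + 2) * 2 / (N + 1) * C + (k + 1) * (k + 2) * 2 / (N + 1) * C := by
          gcongr
          · exact hC _
          · exact hC _
      _ = _ := by ring
  have h0 := tendsto_nhds_unique (S.hasSum.tendsto_sum_nat.comp (tendsto_add_atTop_nat 1))
    (hlim.congr fun N => (sum_kernel_diffOp c k N).symm)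
  rw [s0.tsum_sub (((s1.sub s2).add s3).mul_left _), tsum_mul_left, (s1.sub s2).tsum_add s3,
    s1.tsum_sub s2, tsum_mul_left] at h0
  rw [diffOp_apply]
  simpa only [kernelOp, Nat.add_sub_cancel] using sub_eq_zero.1 h0

lemma kernelOp_aeval {c : ℕ → ℝ} (hc : Tame c) (q : Polynomial ℝ) :
    kernelOp (Polynomial.aeval (diffOp 1) q c) = Polynomial.aeval (diffOp 1) q (kernelOp c) := by
  induction q using Polynomial.induction_on generalizing c with
  | C a => simp [Module.algebraMap_end_apply, kernelOp_smul]
  | add p q hp hq =>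
    rw [map_add, LinearMap.add_apply, LinearMap.add_apply,
      kernelOp_add (hc.aeval p).bddSeq (hc.aeval q).bddSeq, hp hc, hq hc]
  | monomial m a ih =>
    rw [pow_succ, ← mul_assoc, map_mul _ _ Polynomial.X, Polynomial.aeval_X, Module.End.mul_apply,
      Module.End.mul_apply, ih hc.diffOp, kernelOp_diffOp hc.bddSeq hc.diffOp.bddSeq]

end Kernel

section Functionals

lemma v_zero (n : ℕ) (f : ℝ → ℝ) : v n 0 f = f 0 := by simp [v]

lemma v_succ (n k : ℕ) (f : ℝ → ℝ) :
    v n (k + 1) f = ((n : ℝ) + 1) * ∫ t in Ioi (0 : ℝ), P (n + 2) k t * f t := by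
  simp [v]

lemma v_congr {f g : ℝ → ℝ} (h : ∀ x, 0 ≤ x → f x = g x) (n k : ℕ) : v n k f = v n k g := by
  rcases k with _ | k
  · rw [v_zero, v_zero, h 0 le_rfl]
  · rw [v_succ, v_succ]
    congr 1
    refine setIntegral_congr_fun measurableSet_Ioi fun t ht => ?_
    simp only [h t (le_of_lt ht)]

lemma Vt_congr {f g : ℝ → ℝ} (h : ∀ x, 0 ≤ x → f x = g x) (n : ℕ) (x : ℝ) :
    Vt n f x = Vt n g x :=
  tsum_congr fun k => by rw [v_congr h]

variable {f : ℝ → ℝ} {M : ℝ}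

lemma integrable_P_mul (hf : AEStronglyMeasurable f (volume.restrict (Ioi 0)))
    (hM : ∀ x, 0 ≤ x → |f x| ≤ M) (n k : ℕ) :
    Integrable (fun t => P (n + 2) k t * f t) (volume.restrict (Ioi 0)) :=
  Integrable.mul_bdd (c := M) (integral_P (n := n + 1) (by lia) k).1 hf
    ((ae_restrict_iff' measurableSet_Ioi).2 (ae_of_all _ fun x hx => hM x (le_of_lt hx)))

lemma abs_v_le (hM : ∀ x, 0 ≤ x → |f x| ≤ M) (n k : ℕ) : |v n k f| ≤ M := by
  rcases k with _ | k
  · rw [v_zero]; exact hM 0 le_rfl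
  · obtain ⟨h1, h2⟩ := integral_P (n := n + 1) (by lia) k
    have h : ‖∫ t in Ioi (0 : ℝ), P (n + 2) k t * f t‖
        ≤ ∫ t in Ioi (0 : ℝ), P (n + 1 + 1) k t * M := by
      refine norm_integral_le_of_norm_le (h1.mul_const M)
        ((ae_restrict_iff' measurableSet_Ioi).2 (ae_of_all _ fun x hx => ?_))
      have hx : 0 ≤ x := le_of_lt hx
      rw [norm_mul, Real.norm_eq_abs, Real.norm_eq_abs, abs_of_nonneg (P_nonneg _ _ hx)]
      exact mul_le_mul_of_nonneg_left (hM x hx) (P_nonneg _ _ hx)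
    rw [integral_mul_const, h2, Real.norm_eq_abs] at h
    have hn : (0 : ℝ) < n + 1 := by positivity
    rw [v_succ, abs_mul, abs_of_pos hn]
    calc ((n : ℝ) + 1) * |∫ t in Ioi (0 : ℝ), P (n + 2) k t * f t|
        ≤ (n + 1) * (1 / ((n + 1 : ℕ) : ℝ) * M) := by gcongr
      _ = M := by push_cast; field_simp

lemma v_weight_succ (hf : AEStronglyMeasurable f (volume.restrict (Ioi 0)))
    (hM : ∀ x, 0 ≤ x → |f x| ≤ M) (n : ℕ) :
    (fun k => v (n + 1) k f) = raiseOp n fun k => v n k f := by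
  ext k
  have hn : (n : ℝ) + 1 ≠ 0 := by positivity
  rw [raiseOp_apply]
  rcases k with _ | k
  · simp only [v_zero]; field_simp; simp
  · have hn2 : ((n : ℝ) + 2) ≠ 0 := by positivity
    have h1 := integrable_P_mul hf hM n k
    have h2 := integrable_P_mul hf hM n (k + 1)
    have e : ∫ t in Ioi (0 : ℝ), P (n + 1 + 2) k t * f t
        = 1 / ((n : ℝ) + 2) * ((n + 2 + k) * ∫ t in Ioi (0 : ℝ), P (n + 2) k t * f t)
          - 1 / ((n : ℝ) + 2) * ((k + 1) * ∫ t in Ioi (0 : ℝ), P (n + 2) (k + 1 : ℕ) t * f t) := by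
      rw [← integral_const_mul, ← integral_const_mul, ← integral_const_mul, ← integral_const_mul,
        ← integral_sub ((h1.const_mul _).const_mul _) ((h2.const_mul _).const_mul _)]
      refine setIntegral_congr_fun measurableSet_Ioi fun t ht => ?_
      have h := P_weight_succ (n := n + 2) (by lia) k (le_of_lt ht)
      push_cast at h ⊢
      field_simp
      linear_combination f t * h
    simp only [v_succ]
    rw [e]
    push_cast
    field_simp
    ring

lemma tame_v (hf : AEStronglyMeasurable f (volume.restrict (Ioi 0)))
    (hM : ∀ x, 0 ≤ x → |f x| ≤ M) : Tame fun k => v 1 k f :=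
  tame_of_raiseOp (a := fun n k => v n k f) (fun i _ => v_weight_succ hf hM i)
    fun i _ => ⟨M, fun k => abs_v_le hM i k⟩

lemma exists_Vt_eq {n : ℕ} (hn : 1 ≤ n) :
    ∃ r : Polynomial ℝ, ∀ (f : ℝ → ℝ) (M : ℝ),
      AEStronglyMeasurable f (volume.restrict (Ioi 0)) → (∀ x, 0 ≤ x → |f x| ≤ M) →
      ∀ x, 0 ≤ x → Vt n f x = synth 1 (Polynomial.aeval (diffOp 1) r fun k => v 1 k f) x := by
  obtain ⟨r, hr⟩ := exists_synth_one_eq hn (1 - Polynomial.C (1 / (n : ℝ)) * Polynomial.X)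
  refine ⟨r, fun f M hf hM x hx => ?_⟩
  have hg : ∀ i, PolyGrowth fun k => v i k f :=
    fun i => BddSeq.polyGrowth ⟨M, fun k => abs_v_le hM i k⟩
  rw [Vt_eq_synth hn (hg n) hx]
  exact hr (fun i k => v i k f) (fun i _ => v_weight_succ hf hM i) (fun i _ => hg i) x hx

lemma hasSum_P_one {x : ℝ} (hx : 0 ≤ x) : HasSum (fun k : ℕ => P 1 k x) 1 := by
  have hy : x / (1 + x) < 1 := by rw [div_lt_one (by linarith)]; linarith
  have h := (hasSum_geometric_of_lt_one (by positivity) hy).mul_left (1 + x)⁻¹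
  have e1 : (1 + x)⁻¹ * (1 - x / (1 + x))⁻¹ = 1 := by
    have : 1 - x / (1 + x) = (1 + x)⁻¹ := by field_simp; ring
    rw [this, inv_inv, inv_mul_cancel₀ (by positivity)]
  have e : (fun k : ℕ => P 1 k x) = fun k => (1 + x)⁻¹ * (x / (1 + x)) ^ k := by
    ext k
    rw [P_one, pow_add, div_pow]
    field_simp
  rw [e1] at h
  rwa [e]

lemma abs_synth_one_le {c : ℕ → ℝ} {C : ℝ} (hc : ∀ k, |c k| ≤ C) {x : ℝ} (hx : 0 ≤ x) :
    |synth 1 c x| ≤ C := by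
  have h := (hasSum_P_one hx).mul_left C
  rw [mul_one] at h
  show ‖∑' k : ℕ, c k * P 1 k x‖ ≤ C
  refine tsum_of_norm_bounded h fun k => ?_
  rw [Real.norm_eq_abs, abs_mul, abs_of_nonneg (P_nonneg _ _ hx)]
  exact mul_le_mul_of_nonneg_right (hc k) (P_nonneg _ _ hx)

lemma aestronglyMeasurable_P (n k : ℕ) :
    AEStronglyMeasurable (P n k) (volume.restrict (Ioi 0)) :=
  ((continuousOn_P n k).mono Ioi_subset_Ici_self).aestronglyMeasurable measurableSet_Ioi

lemma aestronglyMeasurable_synth {n : ℕ} (hn : 1 ≤ n) {c : ℕ → ℝ} (hc : PolyGrowth c) :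
    AEStronglyMeasurable (synth n c) (volume.restrict (Ioi 0)) := by
  refine aestronglyMeasurable_of_tendsto_ae atTop
    (f := fun N x => ∑ k ∈ Finset.range N, c k * P n k x) (fun N => ?_)
    ((ae_restrict_iff' measurableSet_Ioi).2 (ae_of_all _ fun x hx =>
      (summable_mul_P hn hc (le_of_lt hx)).hasSum.tendsto_sum_nat))
  exact Finset.aestronglyMeasurable_fun_sum _ fun k _ => (aestronglyMeasurable_P n k).const_mul _

lemma P_three_mul_P_one (k j : ℕ) {t : ℝ} (ht : 0 ≤ t) :
    P 3 k t * P 1 j t = 3 / 2 * kernel (k + 1) j * P 4 (k + j : ℕ) t := by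
  have a1 := choose_weight_succ (n := 1) le_rfl k
  have a2 := choose_weight_succ (n := 2) (by norm_num) k
  have b1 := choose_weight_succ (n := 1) le_rfl (k + j)
  have b2 := choose_weight_succ (n := 2) (by norm_num) (k + j)
  have b3 := choose_weight_succ (n := 3) (by norm_num) (k + j)
  simp only [Nat.reduceAdd, Nat.add_sub_cancel_left, Nat.choose_self] at a1 a2 b1 b2 b3
  push_cast at a1 a2 b1 b2 b3
  have hA : ((3 + k - 1).choose k : ℝ) = (2 + k) * (1 + k) / 2 := by
    rw [eq_div_iff (by norm_num)]; linear_combination a2 + (2 + (k : ℝ)) * a1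
  have hB : ((4 + (k + j) - 1).choose (k + j) : ℝ)
      = (3 + k + j) * (2 + k + j) * (1 + k + j) / 6 := by
    rw [eq_div_iff (by norm_num)]
    linear_combination 2 * b3 + (3 + (k : ℝ) + j) * b2
      + (3 + (k : ℝ) + j) * (2 + (k : ℝ) + j) * b1
  have h1 : (1 + t) ≠ 0 := by positivity
  rw [P_natCast 3, P_natCast 4, P_one, hA, hB]
  simp only [kernel, Nat.succ_ne_zero, if_false]
  push_cast
  field_simp
  ring

lemma v_one_synth {c : ℕ → ℝ} (hc : BddSeq c) :
    (fun k => v 1 k (synth 1 c)) = kernelOp c := by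
  ext k
  rcases k with _ | k
  · rw [v_zero, kernelOp_zero, synth, tsum_eq_single 0 fun j hj => by simp [P_zero_right, hj]]
    rw [P_zero_right, if_pos rfl, mul_one]
  · have hF : ∀ j : ℕ, EqOn (fun t => P 3 k t * (c j * P 1 j t))
        (fun t => 3 / 2 * (kernel (k + 1) j * c j) * P 4 (k + j : ℕ) t) (Ioi 0) := by
      intro j t ht
      have h := P_three_mul_P_one k j (le_of_lt ht)
      simp only
      linear_combination c j * h
    have hP := fun j => integral_P (n := 3) (by norm_num) (k + j)
    have hint : ∀ j : ℕ, Integrable (fun t => P 3 k t * (c j * P 1 j t))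
        (volume.restrict (Ioi 0)) := fun j =>
      (integrableOn_congr_fun (hF j) measurableSet_Ioi).2 ((hP j).1.const_mul _)
    have hval : ∀ j : ℕ, ∫ t in Ioi (0 : ℝ), P 3 k t * (c j * P 1 j t)
        = 1 / 2 * (kernel (k + 1) j * c j) := by
      intro j
      rw [setIntegral_congr_fun measurableSet_Ioi (hF j), integral_const_mul, (hP j).2]
      push_cast; ring
    have hnorm : ∀ j : ℕ, ∫ t in Ioi (0 : ℝ), ‖P 3 k t * (c j * P 1 j t)‖
        = 1 / 2 * |kernel (k + 1) j * c j| := by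
      intro j
      have : ∫ t in Ioi (0 : ℝ), ‖P 3 k t * (c j * P 1 j t)‖
          = ∫ t in Ioi (0 : ℝ), 3 / 2 * |kernel (k + 1) j * c j| * P 4 (k + j : ℕ) t := by
        refine setIntegral_congr_fun measurableSet_Ioi fun t ht => ?_
        have h := hF j ht
        simp only at h ⊢
        rw [h, Real.norm_eq_abs, abs_mul, abs_mul, abs_of_nonneg (P_nonneg _ _ (le_of_lt ht))]
        norm_num
      rw [this, integral_const_mul, (hP j).2]
      push_cast; ring
    have h := (hasSum_integral_of_summable_integral_norm hint (by
      simp only [hnorm]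
      exact (summable_kernel_mul (k + 1) hc).abs.mul_left _)).tsum_eq
    simp only [hval, tsum_mul_left] at h
    rw [v_succ, kernelOp]
    have e : ∫ t in Ioi (0 : ℝ), P (1 + 2) k t * synth 1 c t
        = 1 / 2 * ∑' j, kernel (k + 1) j * c j := by
      rw [h]; rfl
    rw [e]
    push_cast; ring

end Functionals

theorem Vt_comm (m n : ℕ) (hm : 1 ≤ m) (hn : 1 ≤ n) (f : ℝ → ℝ) (hf : BddContOn f)
    (hfW : MemW20 f) (hDfW : MemW20 (Dt f))
    (hDf_cont : ContinuousOn (Dt f) (Set.Ioi 0))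
    (hDf_bdd : ∃ M, ∀ x ∈ Set.Ioi (0 : ℝ), |Dt f x| ≤ M)
    (hD2f_cont : ContinuousOn (Dt (Dt f)) (Set.Ioi 0))
    (hD2f_bdd : ∃ M, ∀ x ∈ Set.Ioi (0 : ℝ), |Dt (Dt f) x| ≤ M) :
    ∀ x ∈ Set.Ici (0 : ℝ), Vt m (Vt n f) x = Vt n (Vt m f) x := by
  obtain ⟨hcont, M, hM⟩ := hf
  have hmeas : AEStronglyMeasurable f (volume.restrict (Ioi 0)) :=
    (hcont.mono Ioi_subset_Ici_self).aestronglyMeasurable measurableSet_Ioi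
  have htame := tame_v hmeas hM
  obtain ⟨p, hp⟩ := exists_Vt_eq hm
  obtain ⟨q, hq⟩ := exists_Vt_eq hn
  have key : ∀ {i j : ℕ} {r s : Polynomial ℝ},
      (∀ (g : ℝ → ℝ) (K : ℝ), AEStronglyMeasurable g (volume.restrict (Ioi 0)) →
        (∀ x, 0 ≤ x → |g x| ≤ K) → ∀ x, 0 ≤ x →
        Vt i g x = synth 1 (Polynomial.aeval (diffOp 1) r fun k => v 1 k g) x) →
      (∀ (g : ℝ → ℝ) (K : ℝ), AEStronglyMeasurable g (volume.restrict (Ioi 0)) →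
        (∀ x, 0 ≤ x → |g x| ≤ K) → ∀ x, 0 ≤ x →
        Vt j g x = synth 1 (Polynomial.aeval (diffOp 1) s fun k => v 1 k g) x) →
      ∀ x, 0 ≤ x → Vt i (Vt j f) x
        = synth 1 (Polynomial.aeval (diffOp 1) (r * s) (kernelOp fun k => v 1 k f)) x := by
    intro i j r s hr hs x hx
    have hb := (htame.aeval s).bddSeq
    obtain ⟨K, hK⟩ := hb
    rw [Vt_congr (hs f M hmeas hM) i x,
      hr _ K (aestronglyMeasurable_synth le_rfl (BddSeq.polyGrowth ⟨K, hK⟩))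
        (fun y hy => abs_synth_one_le hK hy) x hx,
      v_one_synth ⟨K, hK⟩, kernelOp_aeval htame, map_mul, Module.End.mul_apply]
  intro x hx
  rw [key hp hq x hx, key hq hp x hx, mul_comm]
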